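/- arXiv:0806.0606 — 4 statements merged into one kernel-verified Lean document; each statement's English description precedes it below -/
import Mathlib

section
/- If p, p′ ∈ P with p ≠ p′, then the translated normal cones ∇ψ(p) + C_p(P) and ∇ψ(p′) + C_{p′}(P) are disjoint. -/
open Set
open scoped RealInnerProductSpace

/-- A vector field whose derivative is bounded below by `m` on a convex set is strongly monotone
there with constant `m`. -/
theorem mul_norm_sub_sq_le_inner_sub_of_le_inner_fderiv {E : Type*} [NormedAddCommGroup E]
    [InnerProductSpace ℝ E] {F : E → E} {s : Set E} {m : ℝ} (hs : Convex ℝ s)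
    (hF : ∀ x ∈ s, DifferentiableAt ℝ F x)
    (hm : ∀ x ∈ s, ∀ v : E, m * ‖v‖ ^ 2 ≤ ⟪v, fderiv ℝ F x v⟫)
    {x y : E} (hx : x ∈ s) (hy : y ∈ s) :
    m * ‖y - x‖ ^ 2 ≤ ⟪y - x, F y - F x⟫ := by
  obtain ⟨z, hz, h⟩ := domain_mvt (f := fun z => ⟪y - x, F z⟫)
    (f' := fun z => (innerSL ℝ (y - x)).comp (fderiv ℝ F z))
    (fun z hz => ((innerSL ℝ (y - x)).hasFDerivAt.comp z
      (hF z hz).hasFDerivAt).hasFDerivWithinAt) hs hx hy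
  rw [inner_sub_right, h]
  exact hm z (hs.segment_subset hx hy hz) (y - x)

/-- The gradient of a `C²` function on an open set is differentiable there. -/
theorem ContDiffOn.differentiableAt_gradient {E : Type*} [NormedAddCommGroup E]
    [InnerProductSpace ℝ E] [CompleteSpace E] {f : E → ℝ} {s : Set E}
    (hf : ContDiffOn ℝ 2 f s) (hs : IsOpen s) {x : E} (hx : x ∈ s) :
    DifferentiableAt ℝ (gradient f) x := by
  have h : DifferentiableAt ℝ (fderiv ℝ f) x :=
    ((hf.contDiffAt (hs.mem_nhds hx)).fderiv_right (m := 1) (by norm_num)).differentiableAt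
      one_ne_zero
  exact (InnerProductSpace.toDual ℝ E).symm.differentiableAt.comp x h

/-- disjointness of translated normal cones.
Let `P ⊆ ℝⁿ` be a compact convex set and `ψ` a `C²` function on an open convex
neighborhood `U` of `P` with `Hess_x ψ ≥ 2c·Id` on `U` for some `c > 0`.  If `p, p′ ∈ P`
with `p ≠ p′`, then the translated normal cones `∇ψ(p) + C_p(P)` and `∇ψ(p′) + C_{p′}(P)`
are disjoint, where `C_p(P) = {c : ⟨c, p − q⟩ ≥ 0 ∀ q ∈ P}`. -/
theorem translated_normal_cones_disjoint {n : ℕ}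
    (U P : Set (EuclideanSpace ℝ (Fin n)))
    (hUopen : IsOpen U) (hUconv : Convex ℝ U)
    (hPU : P ⊆ U) (hPcomp : IsCompact P) (hPconv : Convex ℝ P)
    (ψ : EuclideanSpace ℝ (Fin n) → ℝ) (hψ : ContDiffOn ℝ 2 ψ U)
    (c : ℝ) (hc : 0 < c)
    (hHess : ∀ x ∈ U, ∀ v : EuclideanSpace ℝ (Fin n),
      2 * c * ‖v‖ ^ 2 ≤ ⟪v, fderiv ℝ (gradient ψ) x v⟫)
    (p p' : EuclideanSpace ℝ (Fin n)) (hp : p ∈ P) (hp' : p' ∈ P) (hne : p ≠ p') :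
    Disjoint
      {y : EuclideanSpace ℝ (Fin n) | y - gradient ψ p ∈
        {c' : EuclideanSpace ℝ (Fin n) | ∀ q ∈ P, 0 ≤ ⟪c', p - q⟫}}
      {y : EuclideanSpace ℝ (Fin n) | y - gradient ψ p' ∈
        {c' : EuclideanSpace ℝ (Fin n) | ∀ q ∈ P, 0 ≤ ⟪c', p' - q⟫}} := by
  rw [Set.disjoint_left]
  intro y hy hy'
  have h := hy p' hp'
  have h' := hy' p hp
  have hmono := mul_norm_sub_sq_le_inner_sub_of_le_inner_fderiv hUconv
    (fun x hx => hψ.differentiableAt_gradient hUopen hx) hHess (hPU hp') (hPU hp)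
  have hpos : 0 < 2 * c * ‖p - p'‖ ^ 2 := by
    have := norm_pos_iff.mpr (sub_ne_zero.mpr hne)
    positivity
  rw [real_inner_comm] at hmono
  simp only [inner_sub_left, inner_sub_right] at h h' hmono
  linarith
end

section
/- For every y ∈ ℝⁿ there exists exactly one p ∈ P with y ∈ ∇ψ(p) + C_p(P); hence ℝⁿ is the disjoint union over p ∈ P of the sets ∇ψ(p) + C_p(P), and the projection π : ℝⁿ → ∇ψ(P) defined by π(y) = ∇ψ(p) for y ∈ ∇ψ(p) + C_p(P) is well defined and continuous. -/
open Set
open scoped RealInnerProductSpace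

section StrongMonotonicity

variable {E : Type*} [NormedAddCommGroup E] [InnerProductSpace ℝ E]

/-- A map whose derivative is bounded below by `m` as a quadratic form on a convex open set is
`m`-strongly monotone there. -/
theorem strongly_monotone_of_le_inner_fderiv {U : Set E} (hUopen : IsOpen U)
    (hUconv : Convex ℝ U) {g : E → E} (hg : DifferentiableOn ℝ g U) {m : ℝ}
    (hm : ∀ x ∈ U, ∀ v : E, m * ‖v‖ ^ 2 ≤ ⟪v, fderiv ℝ g x v⟫)
    {p q : E} (hp : p ∈ U) (hq : q ∈ U) :
    m * ‖p - q‖ ^ 2 ≤ ⟪g p - g q, p - q⟫ := by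
  have hmem : ∀ t ∈ Icc (0 : ℝ) 1, q + t • (p - q) ∈ U := fun t ht =>
    hUconv.add_smul_sub_mem hq hp ht
  have hderiv : ∀ t ∈ Icc (0 : ℝ) 1,
      HasDerivAt (fun t : ℝ => ⟪p - q, g (q + t • (p - q))⟫)
        ⟪p - q, fderiv ℝ g (q + t • (p - q)) (p - q)⟫ t := by
    intro t ht
    have hline : HasDerivAt (fun t : ℝ => q + t • (p - q)) (p - q) t := by
      simpa using ((hasDerivAt_id t).smul_const (p - q)).const_add q
    have hgt := ((hg.differentiableAt (hUopen.mem_nhds (hmem t ht))).hasFDerivAt).comp_hasDerivAt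
      t hline
    exact (innerSL ℝ (p - q)).hasFDerivAt.comp_hasDerivAt t hgt
  obtain ⟨t, ht, hslope⟩ := exists_hasDerivAt_eq_slope _ _ (zero_lt_one' ℝ)
    (fun t ht => (hderiv t ht).continuousAt.continuousWithinAt)
    (fun t ht => hderiv t (Ioo_subset_Icc_self ht))
  have hle := hm _ (hmem t (Ioo_subset_Icc_self ht)) (p - q)
  rw [hslope] at hle
  rw [real_inner_comm, inner_sub_right]
  simpa using hle

/-- The solution of the variational inequality of an `m`-strongly monotone map depends on the
data in a Lipschitz way. -/
theorem norm_sub_le_of_variational_inequality {P : Set E} {g : E → E} {m : ℝ} (hm : 0 < m)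
    (hg : ∀ p ∈ P, ∀ q ∈ P, m * ‖p - q‖ ^ 2 ≤ ⟪g p - g q, p - q⟫)
    {y z p q : E} (hp : p ∈ P) (hq : q ∈ P)
    (hyp : ∀ x ∈ P, 0 ≤ ⟪y - g p, p - x⟫) (hzq : ∀ x ∈ P, 0 ≤ ⟪z - g q, q - x⟫) :
    ‖p - q‖ ≤ m⁻¹ * ‖y - z‖ := by
  have h₁ := hyp q hq
  have h₂ := hzq p hp
  have h₃ := hg p hp q hq
  have h₄ : ⟪y - z, p - q⟫ = ⟪y - g p, p - q⟫ + ⟪z - g q, q - p⟫ + ⟪g p - g q, p - q⟫ := by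
    simp only [inner_sub_left, inner_sub_right]
    ring
  have h₅ := real_inner_le_norm (y - z) (p - q)
  rw [← div_eq_inv_mul, le_div_iff₀ hm]
  rcases (norm_nonneg (p - q)).eq_or_lt with h₀ | h₀
  · rw [← h₀, zero_mul]
    positivity
  · refine le_of_mul_le_mul_right ?_ h₀
    nlinarith

/-- First-order optimality: on a nonempty compact convex set the variational inequality of a
gradient is solvable. -/
theorem exists_variational_inequality_gradient [CompleteSpace E] {P : Set E}
    (hPcomp : IsCompact P) (hPconv : Convex ℝ P) (hPne : P.Nonempty) {ψ : E → ℝ}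
    (hψ : ∀ x ∈ P, DifferentiableAt ℝ ψ x) (y : E) :
    ∃ p ∈ P, ∀ q ∈ P, 0 ≤ ⟪y - gradient ψ p, p - q⟫ := by
  have hderiv : ∀ x ∈ P, HasFDerivAt (fun x => ψ x - innerSL ℝ y x)
      (fderiv ℝ ψ x - innerSL ℝ y) x := fun x hx =>
    (hψ x hx).hasFDerivAt.sub (innerSL ℝ y).hasFDerivAt
  obtain ⟨p, hp, hmin⟩ := hPcomp.exists_isMinOn hPne
    (fun x hx => (hderiv x hx).continuousAt.continuousWithinAt)
  refine ⟨p, hp, fun q hq => ?_⟩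
  have h := hmin.localize.hasFDerivWithinAt_nonneg (hderiv p hp).hasFDerivWithinAt
    (sub_mem_posTangentConeAt_of_segment_subset (hPconv.segment_subset hp hq))
  have hgrad : ⟪gradient ψ p, q - p⟫ = fderiv ℝ ψ p (q - p) := by
    simp [gradient]
  have h' : 0 ≤ fderiv ℝ ψ p (q - p) - ⟪y, q - p⟫ := by simpa using h
  rw [← hgrad] at h'
  rw [← neg_sub q p, inner_neg_right, inner_sub_left]
  linarith

theorem ContDiffOn.gradient_of_isOpen [CompleteSpace E] {U : Set E} {ψ : E → ℝ}
    (hψ : ContDiffOn ℝ 2 ψ U) (hU : IsOpen U) : ContDiffOn ℝ 1 (gradient ψ) U :=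
  (InnerProductSpace.toDual ℝ E).symm.contDiff.comp_contDiffOn
    (hψ.fderiv_of_isOpen hU (by norm_num))

end StrongMonotonicity

/-- partition of `ℝⁿ` by translated normal cones and the projection `π`.
Let `P ⊆ ℝⁿ` be a (nonempty) compact convex set and `ψ` a `C²` function on an open convex
neighborhood `U` of `P` with `Hess_x ψ ≥ 2c·Id` on `U` for some `c > 0`.  Then for every
`y ∈ ℝⁿ` there is exactly one `p ∈ P` with `y ∈ ∇ψ(p) + C_p(P)`; hence `ℝⁿ` is the
disjoint union over `p ∈ P` of the sets `∇ψ(p) + C_p(P)`, and the projection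
`π : ℝⁿ → ∇ψ(P)` defined by `π(y) = ∇ψ(p)` for `y ∈ ∇ψ(p) + C_p(P)` is well defined and
continuous. -/
theorem normal_cone_partition_and_projection {n : ℕ}
    (U P : Set (EuclideanSpace ℝ (Fin n)))
    (hUopen : IsOpen U) (hUconv : Convex ℝ U)
    (hPU : P ⊆ U) (hPcomp : IsCompact P) (hPconv : Convex ℝ P) (hPne : P.Nonempty)
    (ψ : EuclideanSpace ℝ (Fin n) → ℝ) (hψ : ContDiffOn ℝ 2 ψ U)
    (c : ℝ) (hc : 0 < c)
    (hHess : ∀ x ∈ U, ∀ v : EuclideanSpace ℝ (Fin n),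
      2 * c * ‖v‖ ^ 2 ≤ ⟪v, fderiv ℝ (gradient ψ) x v⟫) :
    (∀ y : EuclideanSpace ℝ (Fin n),
      ∃! p : EuclideanSpace ℝ (Fin n),
        p ∈ P ∧ (∀ q ∈ P, 0 ≤ ⟪y - gradient ψ p, p - q⟫)) ∧
    ∀ π : EuclideanSpace ℝ (Fin n) → EuclideanSpace ℝ (Fin n),
      (∀ y : EuclideanSpace ℝ (Fin n), ∀ p ∈ P,
        (∀ q ∈ P, 0 ≤ ⟪y - gradient ψ p, p - q⟫) → π y = gradient ψ p) →
      Continuous π := by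
  have hgrad := hψ.gradient_of_isOpen hUopen
  have hmono : ∀ p ∈ P, ∀ q ∈ P,
      2 * c * ‖p - q‖ ^ 2 ≤ ⟪gradient ψ p - gradient ψ q, p - q⟫ := fun p hp q hq =>
    strongly_monotone_of_le_inner_fderiv hUopen hUconv (hgrad.differentiableOn one_ne_zero) hHess
      (hPU hp) (hPU hq)
  have hm : 0 < 2 * c := by positivity
  choose p hpP hp using exists_variational_inequality_gradient hPcomp hPconv hPne
    (fun x hx => (hψ.differentiableOn two_ne_zero).differentiableAt (hUopen.mem_nhds (hPU hx)))
  refine ⟨fun y => ⟨p y, ⟨hpP y, hp y⟩, fun q hq => ?_⟩, fun π hπ => ?_⟩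
  · have h := norm_sub_le_of_variational_inequality hm hmono hq.1 (hpP y) hq.2 (hp y)
    rw [sub_self, norm_zero, mul_zero] at h
    exact sub_eq_zero.1 (norm_le_zero_iff.1 h)
  · have hpcont : Continuous p := by
      refine (LipschitzWith.of_dist_le_mul (K := (2 * c)⁻¹.toNNReal) fun y z => ?_).continuous
      rw [dist_eq_norm, dist_eq_norm, Real.coe_toNNReal _ (by positivity)]
      exact norm_sub_le_of_variational_inequality hm hmono (hpP y) (hpP z) (hp y) (hp z)
    rw [show π = fun y => gradient ψ (p y) from funext fun y => hπ y (p y) (hpP y) (hp y)]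
    exact hgrad.continuousOn.comp_continuous hpcont fun y => hPU (hpP y)
end

section
/- Assume each κ_s : int P → ℝⁿ (s > 0) is a bijection. Then for every y ∈ ℝⁿ, κ_s^{−1}(y) converges as s → ∞ to the unique point p ∈ P with y ∈ ∇ψ(p) + C_p(P); equivalently, ∇ψ(κ_s^{−1}(y)) → π(y) pointwise on ℝⁿ, where π is the projection sending every point of ∇ψ(p) + C_p(P) to ∇ψ(p). -/
open Filter Set
open scoped RealInnerProductSpace Topology BigOperators

/-- A lower bound `m` on the derivative of a vector field on a convex set gives strong
monotonicity of the field. -/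
theorem inner_sub_le_of_fderiv_lower_bound {E : Type*} [NormedAddCommGroup E]
    [InnerProductSpace ℝ E] {f : E → E} {U : Set E} (hU : Convex ℝ U)
    (hf : ∀ x ∈ U, DifferentiableAt ℝ f x) {m : ℝ}
    (hm : ∀ x ∈ U, ∀ v : E, m * ‖v‖ ^ 2 ≤ ⟪v, fderiv ℝ f x v⟫)
    {x y : E} (hx : x ∈ U) (hy : y ∈ U) :
    m * ‖y - x‖ ^ 2 ≤ ⟪y - x, f y - f x⟫ := by
  have hseg : ∀ t ∈ Icc (0 : ℝ) 1, x + t • (y - x) ∈ U := fun t ht =>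
    hU.add_smul_sub_mem hx hy ht
  have hd : ∀ t ∈ Icc (0 : ℝ) 1, HasDerivAt (fun t : ℝ => ⟪y - x, f (x + t • (y - x))⟫)
      ⟪y - x, fderiv ℝ f (x + t • (y - x)) (y - x)⟫ t := by
    intro t ht
    have h1 : HasDerivAt (fun t : ℝ => x + t • (y - x)) (y - x) t := by
      simpa using ((hasDerivAt_id t).smul_const (y - x)).const_add x
    have h2 := (hf _ (hseg t ht)).hasFDerivAt.comp_hasDerivAt t h1
    simpa using (hasDerivAt_const t (y - x)).inner ℝ h2
  obtain ⟨t, ht, hslope⟩ := exists_hasDerivAt_eq_slope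
    (fun t : ℝ => ⟪y - x, f (x + t • (y - x))⟫) _ zero_lt_one
    (fun t ht => (hd t ht).continuousAt.continuousWithinAt)
    (fun t ht => hd t (Ioo_subset_Icc_self ht))
  have := hm _ (hseg t (Ioo_subset_Icc_self ht)) (y - x)
  rw [hslope] at this
  simpa [inner_sub_right] using this

theorem differentiableAt_gradient_of_contDiffAt {E : Type*} [NormedAddCommGroup E]
    [InnerProductSpace ℝ E] [CompleteSpace E] {f : E → ℝ} {x : E} (hf : ContDiffAt ℝ 2 f x) :
    DifferentiableAt ℝ (gradient f) x := by
  have h : DifferentiableAt ℝ (fderiv ℝ f) x :=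
    (hf.fderiv_right (m := 1) (by norm_num)).differentiableAt (by norm_num)
  exact (InnerProductSpace.toDual ℝ E).symm.toContinuousLinearEquiv.differentiableAt.comp x h

/-- An affine function which is nonnegative on a set is positive on its interior, unless its
linear part vanishes. -/
theorem inner_sub_pos_of_mem_interior {E : Type*} [NormedAddCommGroup E]
    [InnerProductSpace ℝ E] {S : Set E} {a : E} {b : ℝ} (ha : a ≠ 0)
    (hS : ∀ x ∈ S, 0 ≤ ⟪a, x⟫ - b) {x : E} (hx : x ∈ interior S) : 0 < ⟪a, x⟫ - b := by
  have hcont : Tendsto (fun t : ℝ => x - t • a) (𝓝[>] 0) (𝓝 x) := by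
    have : Continuous (fun t : ℝ => x - t • a) := by fun_prop
    simpa using (this.tendsto 0).mono_left nhdsWithin_le_nhds
  obtain ⟨t, ht, ht0⟩ :=
    ((hcont.eventually (mem_interior_iff_mem_nhds.mp hx)).and self_mem_nhdsWithin).exists
  have h := hS _ ht
  have hpos : 0 < t * ⟪a, a⟫ := mul_pos ht0 (real_inner_self_pos.mpr ha)
  rw [inner_sub_right, inner_smul_right] at h
  linarith

/-- The gradient of Guillemin's potential plus a smooth perturbation. -/
theorem hasGradientAt_guillemin_add {E : Type*} [NormedAddCommGroup E]
    [InnerProductSpace ℝ E] [CompleteSpace E] {ι : Type*} [Fintype ι] {ν : ι → E} {lam : ι → ℝ}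
    {φ : E → ℝ} {x : E} (hpos : ∀ r, 0 < ⟪ν r, x⟫ - lam r) (hφ : DifferentiableAt ℝ φ x) :
    HasGradientAt (fun y =>
        (1 / 2) * ∑ r, (⟪ν r, y⟫ - lam r) * Real.log (⟪ν r, y⟫ - lam r) + φ y)
      ((1 / 2 : ℝ) • ∑ r, (Real.log (⟪ν r, x⟫ - lam r) + 1) • ν r + gradient φ x) x := by
  have hterm : ∀ r, HasFDerivAt (fun y => (⟪ν r, y⟫ - lam r) * Real.log (⟪ν r, y⟫ - lam r))
      ((Real.log (⟪ν r, x⟫ - lam r) + 1) • innerSL ℝ (ν r)) x := by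
    intro r
    have hlin : HasFDerivAt (fun y => ⟪ν r, y⟫ - lam r) (innerSL ℝ (ν r)) x :=
      (innerSL ℝ (ν r)).hasFDerivAt.sub_const (lam r)
    exact (Real.hasDerivAt_mul_log (hpos r).ne').comp_hasFDerivAt x hlin
  have h := ((HasFDerivAt.fun_sum (u := Finset.univ) fun r _ => hterm r).const_mul
    (1 / 2)).fun_add hφ.hasGradientAt.hasFDerivAt
  rw [hasGradientAt_iff_hasFDerivAt]
  refine h.congr_fderiv ?_
  ext v
  simp

theorem log_add_one_mul_sub_le {a t : ℝ} (ha : 0 ≤ a) (ht : 0 < t) :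
    (Real.log t + 1) * (a - t) ≤ a * t + 1 := by
  have h1 : Real.log t ≤ t - 1 := Real.log_le_sub_one_of_pos ht
  have h2 : 1 - t⁻¹ ≤ Real.log t := Real.one_sub_inv_le_log_of_pos ht
  have h3 : t * (1 - t⁻¹) ≤ t * Real.log t := mul_le_mul_of_nonneg_left h2 ht.le
  have h4 : a * Real.log t ≤ a * (t - 1) := mul_le_mul_of_nonneg_left h1 ha
  rw [mul_sub, mul_inv_cancel₀ ht.ne'] at h3
  linarith

/-- pointwise convergence of the inverse rescaled Legendre transforms.
Let `P` be a compact simple polytope with nonempty interior, `g_P` the Guillemin potential,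
`φ` smooth near `P`, `ψ` a `C²` function on an open convex neighborhood of `P` with
`Hess ψ ≥ 2c·Id`, and `κ_s = ∇ψ + (1/s)∇(g_P + φ)` on `int P`.  Assume each
`κ_s : int P → ℝⁿ` (`s > 0`) is a bijection.  Then for every `y ∈ ℝⁿ`, `κ_s⁻¹(y)`
converges as `s → ∞` to the unique point `p ∈ P` with `y ∈ ∇ψ(p) + C_p(P)`. -/
theorem inverse_kappa_pointwise_limit {n d : ℕ}
    (ν : Fin d → EuclideanSpace ℝ (Fin n)) (lam : Fin d → ℝ)
    (P : Set (EuclideanSpace ℝ (Fin n)))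
    (hPdef : P = {x | ∀ r, 0 ≤ ⟪ν r, x⟫ - lam r})
    (hPcomp : IsCompact P) (hPint : (interior P).Nonempty)
    (hsimple : ∀ q ∈ P,
      LinearIndependent ℝ (fun r : {r : Fin d // ⟪ν r, q⟫ - lam r = 0} => ν r.1))
    (φ : EuclideanSpace ℝ (Fin n) → ℝ)
    (V : Set (EuclideanSpace ℝ (Fin n))) (hVopen : IsOpen V) (hPV : P ⊆ V)
    (hφ : ContDiffOn ℝ (⊤ : ℕ∞) φ V)
    (U : Set (EuclideanSpace ℝ (Fin n))) (hUopen : IsOpen U) (hUconv : Convex ℝ U)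
    (hPU : P ⊆ U)
    (ψ : EuclideanSpace ℝ (Fin n) → ℝ) (hψ : ContDiffOn ℝ 2 ψ U)
    (c : ℝ) (hc : 0 < c)
    (hHess : ∀ x ∈ U, ∀ v : EuclideanSpace ℝ (Fin n),
      2 * c * ‖v‖ ^ 2 ≤ ⟪v, fderiv ℝ (gradient ψ) x v⟫)
    (κ : ℝ → EuclideanSpace ℝ (Fin n) → EuclideanSpace ℝ (Fin n))
    (hκ : ∀ s x, κ s x = gradient ψ x + (1 / s) •
      gradient (fun y =>
        (1 / 2) * ∑ r, (⟪ν r, y⟫ - lam r) * Real.log (⟪ν r, y⟫ - lam r) + φ y) x)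
    (hbij : ∀ s : ℝ, 0 < s → BijOn (κ s) (interior P) univ) :
    ∀ y : EuclideanSpace ℝ (Fin n), ∀ p ∈ P,
      (∀ q ∈ P, 0 ≤ ⟪y - gradient ψ p, p - q⟫) →
      Tendsto (fun s : ℝ => Function.invFunOn (κ s) (interior P) y) atTop (𝓝 p) := by
  intro y p hp hnormal
  have hPnn : ∀ x ∈ P, ∀ r, 0 ≤ ⟪ν r, x⟫ - lam r := fun x hx => by
    rw [hPdef] at hx; exact hx
  have hpos : ∀ x ∈ interior P, ∀ r, 0 < ⟪ν r, x⟫ - lam r := by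
    intro x hx r
    by_cases hν : ν r = 0
    · refine (hPnn x (interior_subset hx) r).lt_of_ne' fun h0 => ?_
      exact (hsimple x (interior_subset hx)).ne_zero ⟨r, h0⟩ hν
    · exact inner_sub_pos_of_mem_interior hν (fun z hz => hPnn z hz r) hx
  have hφdiff : ∀ x ∈ P, DifferentiableAt ℝ φ x := fun x hx =>
    (hφ.contDiffAt (hVopen.mem_nhds (hPV hx))).differentiableAt (by simp)
  have hgradφ : ContinuousOn (gradient φ) P :=
    (InnerProductSpace.toDual ℝ _).symm.continuous.comp_continuousOn
      ((hφ.continuousOn_fderiv_of_isOpen hVopen (by simp)).mono hPV)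
  obtain ⟨K, hK⟩ : ∃ K : ℝ, ∀ x ∈ P,
      (1 / 2) * ∑ r, ((⟪ν r, p⟫ - lam r) * (⟪ν r, x⟫ - lam r) + 1)
        + ⟪gradient φ x, p - x⟫ ≤ K := by
    have hcont : ContinuousOn (fun x =>
        (1 / 2) * ∑ r, ((⟪ν r, p⟫ - lam r) * (⟪ν r, x⟫ - lam r) + 1)
          + ⟪gradient φ x, p - x⟫) P :=
      Continuous.continuousOn (by fun_prop) |>.add (hgradφ.inner (by fun_prop))
    obtain ⟨K, hK⟩ := hPcomp.bddAbove_image hcont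
    exact ⟨K, fun x hx => hK (mem_image_of_mem _ hx)⟩
  have hbound : ∀ s : ℝ, 0 < s →
      ‖Function.invFunOn (κ s) (interior P) y - p‖ ^ 2 ≤ K / (2 * c) / s := by
    intro s hs
    have hy : y ∈ κ s '' interior P := (hbij s hs).surjOn (mem_univ y)
    have hxint := Function.invFunOn_mem hy
    have hxy := Function.invFunOn_eq hy
    set x := Function.invFunOn (κ s) (interior P) y
    have hxP := interior_subset hxint
    have hmono := inner_sub_le_of_fderiv_lower_bound hUconv
      (fun z hz => differentiableAt_gradient_of_contDiffAt
        (hψ.contDiffAt (hUopen.mem_nhds hz))) hHess (hPU hp) (hPU hxP)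
    have hsum : ∑ r, (Real.log (⟪ν r, x⟫ - lam r) + 1) * ⟪ν r, p - x⟫ ≤
        ∑ r, ((⟪ν r, p⟫ - lam r) * (⟪ν r, x⟫ - lam r) + 1) := by
      refine Finset.sum_le_sum fun r _ => ?_
      have h := log_add_one_mul_sub_le (hPnn p hp r) (hpos x hxint r)
      rwa [sub_sub_sub_cancel_right, ← inner_sub_right] at h
    have hxK := hK x hxP
    rw [hκ, (hasGradientAt_guillemin_add (hpos x hxint) (hφdiff x hxP)).gradient] at hxy
    set G := (1 / 2 : ℝ) • ∑ r, (Real.log (⟪ν r, x⟫ - lam r) + 1) • ν r + gradient φ x with hG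
    have hGK : ⟪G, p - x⟫ ≤ K := by
      rw [hG, inner_add_left, real_inner_smul_left, sum_inner]
      simp only [real_inner_smul_left]
      linarith
    have hn := hnormal x hxP
    have hsplit : ⟪x - p, gradient ψ x - gradient ψ p⟫ =
        (1 / s) * ⟪G, p - x⟫ - ⟪y - gradient ψ p, p - x⟫ := by
      rw [← hxy, real_inner_comm, ← neg_sub p x, inner_neg_right, ← real_inner_smul_left,
        ← inner_sub_left, ← inner_neg_left]
      congr 1
      abel
    have hGs : (1 / s) * ⟪G, p - x⟫ ≤ (1 / s) * K :=
      mul_le_mul_of_nonneg_left hGK (by positivity)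
    rw [div_div, le_div_iff₀ (by positivity)]
    have h : 2 * c * ‖x - p‖ ^ 2 ≤ K / s := by
      rw [div_eq_mul_one_div, mul_comm K]; linarith
    rw [le_div_iff₀ hs] at h
    linarith
  rw [tendsto_iff_norm_sub_tendsto_zero]
  have hsq : Tendsto (fun s : ℝ => ‖Function.invFunOn (κ s) (interior P) y - p‖ ^ 2)
      atTop (𝓝 0) :=
    squeeze_zero' (Eventually.of_forall fun s => by positivity)
      ((eventually_gt_atTop 0).mono hbound) (tendsto_const_nhds.div_atTop tendsto_id)
  simpa using hsq.sqrt
end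

section
/- A point p ∈ P belongs to the GQ limit amoeba A_lim^GQ(P, ψ) if and only if one of the following two mutually exclusive conditions holds: (1) there are at least two distinct lattice points m₁ ≠ m₂ ∈ P ∩ ℤⁿ with ‖p − m₁‖_G = ‖p − m₂‖_G = min_{m ∈ P∩ℤⁿ}‖p − m‖_G; or (2) p ∈ ∂P and the unique lattice point m_p ∈ P ∩ ℤⁿ minimizing ‖p − m‖_G does not lie in the minimal face F_p of P containing p. -/
open Set
open scoped RealInnerProductSpace BigOperators

/-- The set of lattice points of `P ⊆ ℝⁿ`: points of `P` with all coordinates integral. -/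
def latticePoints (n : ℕ) (P : Set (EuclideanSpace ℝ (Fin n))) :
    Set (EuclideanSpace ℝ (Fin n)) :=
  {x ∈ P | ∀ i, ∃ z : ℤ, x i = (z : ℝ)}

/-- The normal cone `C_p(P) = {c : ⟨c, p − q⟩ ≥ 0 for all q ∈ P}` of `P` at `p`. -/
def normalCone (n : ℕ) (P : Set (EuclideanSpace ℝ (Fin n)))
    (p : EuclideanSpace ℝ (Fin n)) : Set (EuclideanSpace ℝ (Fin n)) :=
  {c | ∀ q ∈ P, 0 ≤ ⟪c, p - q⟫}

/-- The tropical amoeba `A_trop(S, v)`: the set of `u ∈ ℝⁿ` where the maximum of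
`m ↦ ⟨m, u⟩ − v(m)` over `S` is attained by at least two distinct elements of `S`. -/
def tropicalAmoeba (n : ℕ) (S : Set (EuclideanSpace ℝ (Fin n)))
    (v : EuclideanSpace ℝ (Fin n) → ℝ) : Set (EuclideanSpace ℝ (Fin n)) :=
  {u | ∃ m₁ ∈ S, ∃ m₂ ∈ S, m₁ ≠ m₂ ∧
    (∀ m ∈ S, ⟪m, u⟫ - v m ≤ ⟪m₁, u⟫ - v m₁) ∧
    ⟪m₁, u⟫ - v m₁ = ⟪m₂, u⟫ - v m₂}

/-- The GQ limit amoeba `A_lim^GQ(P, ψ) = {x ∈ P : ∃ c ∈ C_x(P), ∇ψ(x) + c ∈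
A_trop(P ∩ ℤⁿ, ψ)}`. -/
noncomputable def gqLimitAmoeba (n : ℕ) (P : Set (EuclideanSpace ℝ (Fin n)))
    (ψ : EuclideanSpace ℝ (Fin n) → ℝ) : Set (EuclideanSpace ℝ (Fin n)) :=
  {x ∈ P | ∃ c ∈ normalCone n P x,
    gradient ψ x + c ∈ tropicalAmoeba n (latticePoints n P) ψ}

/-- The quadratic form `vᵀ H v` of a matrix `H` on `ℝⁿ`. -/
def quadForm (n : ℕ) (H : Matrix (Fin n) (Fin n) ℝ)
    (v : EuclideanSpace ℝ (Fin n)) : ℝ :=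
  ∑ i, ∑ j, v i * H i j * v j

/-- The norm `‖v‖_H = √(vᵀ H v)` associated to a (symmetric positive definite) matrix. -/
noncomputable def matNorm (n : ℕ) (H : Matrix (Fin n) (Fin n) ℝ)
    (v : EuclideanSpace ℝ (Fin n)) : ℝ :=
  Real.sqrt (quadForm n H v)

theorem quadForm_eq_inner (n : ℕ) (G : Matrix (Fin n) (Fin n) ℝ) (v : EuclideanSpace ℝ (Fin n)) :
    quadForm n G v = ⟪v, Matrix.toEuclideanCLM (n := Fin n) (𝕜 := ℝ) G v⟫ := by
  simp only [quadForm, PiLp.inner_apply, Matrix.ofLp_toEuclideanCLM, Matrix.mulVec, dotProduct,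
    RCLike.inner_apply, conj_trivial, Finset.sum_mul]
  exact Finset.sum_congr rfl fun i _ => Finset.sum_congr rfl fun j _ => by ring

theorem quadForm_nonneg {n : ℕ} {G : Matrix (Fin n) (Fin n) ℝ} (hG : G.PosSemidef)
    (v : EuclideanSpace ℝ (Fin n)) : 0 ≤ quadForm n G v := by
  have h := hG.dotProduct_mulVec_nonneg v.ofLp
  have e : quadForm n G v = star v.ofLp ⬝ᵥ G.mulVec v.ofLp := by
    simp only [quadForm, Matrix.mulVec, dotProduct, star_trivial, Finset.mul_sum]
    exact Finset.sum_congr rfl fun i _ => Finset.sum_congr rfl fun j _ => by ring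
  rwa [e]

theorem inner_toEuclideanCLM_comm {n : ℕ} {G : Matrix (Fin n) (Fin n) ℝ} (hG : G.IsSymm)
    (v w : EuclideanSpace ℝ (Fin n)) :
    ⟪v, Matrix.toEuclideanCLM (n := Fin n) (𝕜 := ℝ) G w⟫ =
      ⟪w, Matrix.toEuclideanCLM (n := Fin n) (𝕜 := ℝ) G v⟫ := by
  simp only [PiLp.inner_apply, Matrix.ofLp_toEuclideanCLM, Matrix.mulVec, dotProduct,
    RCLike.inner_apply, conj_trivial, Finset.sum_mul]
  rw [Finset.sum_comm]
  exact Finset.sum_congr rfl fun i _ => Finset.sum_congr rfl fun j _ => by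
    rw [hG.apply]; ring

/-- Completing the square: the Legendre-type expression at `∇ψ(p)` is, up to a constant,
minus half the squared `G`-distance to `p`. -/
theorem inner_gradient_sub_quadratic {n : ℕ} {G : Matrix (Fin n) (Fin n) ℝ} (hG : G.IsSymm)
    (b : EuclideanSpace ℝ (Fin n)) (ψ : EuclideanSpace ℝ (Fin n) → ℝ)
    (hψ : ∀ x, ψ x = (1 / 2) * quadForm n G x + ⟪b, x⟫) (p m : EuclideanSpace ℝ (Fin n)) :
    ⟪m, gradient ψ p⟫ - ψ m = (1 / 2) * quadForm n G p - (1 / 2) * quadForm n G (p - m) := by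
  set A := Matrix.toEuclideanCLM (n := Fin n) (𝕜 := ℝ) G with hA
  have hsymm : ∀ v w, ⟪v, A w⟫ = ⟪w, A v⟫ := inner_toEuclideanCLM_comm hG
  have hd := (((hasFDerivAt_id (𝕜 := ℝ) p).inner ℝ (A.hasFDerivAt (x := p))).const_mul
    (1 / 2 : ℝ)).add ((innerSL ℝ b).hasFDerivAt (x := p))
  have hψ' : (fun y => (1 / 2 : ℝ) * ⟪id y, A y⟫) + ⇑(innerSL ℝ b) = ψ := by
    funext x
    rw [hψ, quadForm_eq_inner]
    rfl
  rw [hψ'] at hd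
  have hgrad : ⟪m, gradient ψ p⟫ = ⟪m, A p⟫ + ⟪b, m⟫ := by
    rw [real_inner_comm, gradient, InnerProductSpace.toDual_symm_apply, hd.fderiv]
    simp [fderivInnerCLM_apply, hsymm p m]
    ring
  rw [hgrad, hψ, quadForm_eq_inner, quadForm_eq_inner, quadForm_eq_inner, ← hA]
  simp only [map_sub, inner_sub_left, inner_sub_right, hsymm p m]
  ring

/-- A linear functional maximised over a polyhedron at `p` is constant on the minimal face of `p`. -/
theorem inner_eq_of_mem_normalCone_of_mem_face {n d : ℕ}
    {ν : Fin d → EuclideanSpace ℝ (Fin n)} {lam : Fin d → ℝ} {p q c : EuclideanSpace ℝ (Fin n)}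
    (hp : ∀ r, 0 ≤ ⟪ν r, p⟫ - lam r) (hq : ∀ r, 0 ≤ ⟪ν r, q⟫ - lam r)
    (hc : c ∈ normalCone n {x | ∀ r, 0 ≤ ⟪ν r, x⟫ - lam r} p)
    (hface : ∀ r, ⟪ν r, p⟫ - lam r = 0 → ⟪ν r, q⟫ - lam r = 0) :
    ⟪c, q⟫ = ⟪c, p⟫ := by
  have h1 := hc q hq
  have hev : ∀ᶠ t : ℝ in nhdsWithin 0 (Ioi 0),
      ∀ r, 0 ≤ ⟪ν r, p + t • (p - q)⟫ - lam r := by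
    rw [Filter.eventually_all]
    intro r
    rcases (hp r).eq_or_lt with h0 | h0
    · refine Filter.Eventually.of_forall fun t => ?_
      have h2 := hface r h0.symm
      rw [inner_add_right, inner_smul_right, inner_sub_right]
      have : ⟪ν r, p⟫ - ⟪ν r, q⟫ = 0 := by linarith
      rw [this]
      linarith
    · have hcont : Continuous fun t : ℝ => ⟪ν r, p + t • (p - q)⟫ - lam r := by fun_prop
      have h2 := (hcont.tendsto 0).eventually (lt_mem_nhds (a := 0) (by simpa using h0))
      exact (h2.filter_mono nhdsWithin_le_nhds).mono fun t ht => ht.le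
  obtain ⟨t, ht, ht0⟩ := (hev.and self_mem_nhdsWithin).exists
  have h2 := hc _ ht
  rw [sub_add_cancel_left, inner_neg_right, inner_smul_right] at h2
  have h3 : ⟪c, p - q⟫ ≤ 0 := by
    by_contra! h
    have := mul_pos ht0 h
    linarith
  rw [inner_sub_right] at h1 h3
  linarith

/-- A linear functional that is nonnegative on `S` and vanishes at a point of the convex hull
of `S` vanishes at some point of `S`. -/
theorem exists_mem_inner_eq_of_mem_convexHull {E : Type*} [NormedAddCommGroup E]
    [InnerProductSpace ℝ E] {S : Set E} {v p : E} {a : ℝ} (hp : p ∈ convexHull ℝ S)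
    (hS : ∀ m ∈ S, a ≤ ⟪v, m⟫) (hpa : ⟪v, p⟫ = a) : ∃ m ∈ S, ⟪v, m⟫ = a := by
  by_contra! h
  have hconv : Convex ℝ {x : E | a < ⟪v, x⟫} :=
    convex_halfSpace_gt (innerSL ℝ v).toLinearMap.isLinear a
  have := convexHull_min (fun m hm => (hS m hm).lt_of_ne (h m hm).symm) hconv hp
  exact absurd hpa (ne_of_gt this)

/-- Decreasing the weight `f - t • g` until the strict maximiser of `f` ties with a competitor. -/
theorem exists_nonneg_tie {α : Type*} {S : Set α} (hS : S.Finite) {f g : α → ℝ} {x y : α}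
    (hy : y ∈ S) (hmax : ∀ m ∈ S, f m ≤ f x) (hg : g y < g x) :
    ∃ t : ℝ, 0 ≤ t ∧ ∃ z ∈ S, z ≠ x ∧ (∀ m ∈ S, f m - t * g m ≤ f x - t * g x) ∧
      f x - t * g x = f z - t * g z := by
  obtain ⟨z, ⟨hz, hzg⟩, hmin⟩ := Set.exists_min_image {m ∈ S | g m < g x}
    (fun m => (f x - f m) / (g x - g m)) (hS.subset (sep_subset _ _)) ⟨y, hy, hg⟩
  have hz0 : 0 < g x - g z := sub_pos.2 hzg
  have ht : 0 ≤ (f x - f z) / (g x - g z) := div_nonneg (sub_nonneg.2 (hmax z hz)) hz0.le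
  refine ⟨_, ht, z, hz, fun h => hzg.ne (h ▸ rfl), fun m hm => ?_, ?_⟩
  · rcases lt_or_ge (g m) (g x) with h | h
    · have := (le_div_iff₀ (sub_pos.2 h)).1 (hmin m ⟨hm, h⟩)
      linarith
    · have := mul_le_mul_of_nonneg_left h ht
      linarith [hmax m hm]
  · have := div_mul_cancel₀ (f x - f z) hz0.ne'
    linarith

/-- characterization of the GQ limit amoeba for quadratic `ψ`.
Let `P = {x : ℓ_r(x) ≥ 0, r = 1,…,d}` be a compact lattice polytope and
`ψ(x) = ½ xᵀGx + bᵀx` with `G` symmetric positive definite.  A point `p ∈ P` belongs to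
the GQ limit amoeba `A_lim^GQ(P, ψ)` if and only if either (1) there are at least two
distinct lattice points `m₁ ≠ m₂ ∈ P ∩ ℤⁿ` at minimal `‖·‖_G`-distance from `p`, or
(2) `p ∈ ∂P` and the unique nearest lattice point `m_p` does not lie in the minimal face
`F_p = {x ∈ P : ℓ_r(x) = 0 for every r with ℓ_r(p) = 0}` of `P` containing `p`. -/
theorem gq_amoeba_characterization_quadratic {n d : ℕ}
    (ν : Fin d → EuclideanSpace ℝ (Fin n)) (lam : Fin d → ℝ)
    (P : Set (EuclideanSpace ℝ (Fin n)))
    (hPdef : P = {x | ∀ r, 0 ≤ ⟪ν r, x⟫ - lam r})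
    (hPcomp : IsCompact P)
    (hlatne : (latticePoints n P).Nonempty) (hlatfin : (latticePoints n P).Finite)
    (hhull : P = convexHull ℝ (latticePoints n P))
    (G : Matrix (Fin n) (Fin n) ℝ) (hGsym : G.IsSymm) (hGpd : G.PosDef)
    (b : EuclideanSpace ℝ (Fin n))
    (ψ : EuclideanSpace ℝ (Fin n) → ℝ)
    (hψdef : ∀ x, ψ x = (1 / 2) * quadForm n G x + ⟪b, x⟫) :
    ∀ p ∈ P,
      (p ∈ gqLimitAmoeba n P ψ ↔
        ((∃ m₁ ∈ latticePoints n P, ∃ m₂ ∈ latticePoints n P, m₁ ≠ m₂ ∧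
            matNorm n G (p - m₁) = matNorm n G (p - m₂) ∧
            ∀ m ∈ latticePoints n P, matNorm n G (p - m₁) ≤ matNorm n G (p - m)) ∨
          (p ∈ frontier P ∧
            ∃ mp ∈ latticePoints n P,
              (∀ m ∈ latticePoints n P, m ≠ mp →
                matNorm n G (p - mp) < matNorm n G (p - m)) ∧
              mp ∉ {x ∈ P | ∀ r, ⟪ν r, p⟫ - lam r = 0 → ⟪ν r, x⟫ - lam r = 0}))) := by
  intro p hp
  have hQ : ∀ m, 0 ≤ quadForm n G (p - m) := fun m => quadForm_nonneg hGpd.posSemidef _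
  have hle : ∀ m m', matNorm n G (p - m) ≤ matNorm n G (p - m') ↔
      quadForm n G (p - m) ≤ quadForm n G (p - m') := fun m m' => Real.sqrt_le_sqrt_iff (hQ m')
  have hlt : ∀ m m', matNorm n G (p - m) < matNorm n G (p - m') ↔
      quadForm n G (p - m) < quadForm n G (p - m') := fun m m' => Real.sqrt_lt_sqrt_iff (hQ m)
  have heq : ∀ m m', matNorm n G (p - m) = matNorm n G (p - m') ↔
      quadForm n G (p - m) = quadForm n G (p - m') := fun m m' => Real.sqrt_inj (hQ m) (hQ m')
  have key : ∀ c m, ⟪m, gradient ψ p + c⟫ - ψ m =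
      (1 / 2) * quadForm n G p - (1 / 2) * quadForm n G (p - m) + ⟪c, m⟫ := fun c m => by
    rw [← inner_gradient_sub_quadratic hGsym b ψ hψdef p m, inner_add_right, real_inner_comm m c]
    ring
  have hP : ∀ x, x ∈ P ↔ ∀ r, 0 ≤ ⟪ν r, x⟫ - lam r := fun x => by rw [hPdef]; rfl
  simp only [hle, hlt, heq]
  constructor
  · rintro ⟨-, c, hc, m₁, hm₁, m₂, hm₂, hne, hmax, htie⟩
    simp only [key] at hmax htie
    obtain ⟨mp, hmp, hmin⟩ :=
      Set.exists_min_image _ (fun m => quadForm n G (p - m)) hlatfin hlatne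
    by_cases htwo : ∃ m ∈ latticePoints n P, m ≠ mp ∧
        quadForm n G (p - m) ≤ quadForm n G (p - mp)
    · obtain ⟨m, hm, hmne, hmle⟩ := htwo
      exact Or.inl ⟨mp, hmp, m, hm, hmne.symm, le_antisymm (hmin m hm) hmle, hmin⟩
    push Not at htwo
    have hnot : mp ∉ {x ∈ P | ∀ r, ⟪ν r, p⟫ - lam r = 0 → ⟪ν r, x⟫ - lam r = 0} := by
      rintro ⟨-, hface⟩
      have hcface := inner_eq_of_mem_normalCone_of_mem_face ((hP p).1 hp) ((hP mp).1 hmp.1)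
        (hPdef ▸ hc) hface
      have hbig : ∀ m ∈ latticePoints n P, m ≠ mp →
          - (1 / 2) * quadForm n G (p - m) + ⟪c, m⟫ <
            - (1 / 2) * quadForm n G (p - mp) + ⟪c, mp⟫ := fun m hm hmne => by
        have h1 := htwo m hm hmne
        have h2 := hc m hm.1
        rw [inner_sub_right] at h2
        linarith
      have h0 := hmax mp hmp
      by_cases h : m₁ = mp
      · have := hbig m₂ hm₂ fun h' => hne (h.trans h'.symm)
        linarith
      · have := hbig m₁ hm₁ h
        linarith
    refine Or.inr ⟨⟨subset_closure hp, fun hpint => hnot ⟨hmp.1, fun r hr => ?_⟩⟩,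
      mp, hmp, htwo, hnot⟩
    have hcont : Continuous fun t : ℝ => p + t • (p - mp) := by fun_prop
    have hev := (hcont.tendsto 0).eventually
      (show ∀ᶠ x in nhds (p + (0 : ℝ) • (p - mp)), x ∈ P by
        simpa using mem_interior_iff_mem_nhds.1 hpint)
    obtain ⟨t, ht, ht0⟩ :=
      ((hev.filter_mono nhdsWithin_le_nhds).and (self_mem_nhdsWithin (s := Ioi 0))).exists
    have h1 := (hP _).1 ht r
    have h2 := (hP mp).1 hmp.1 r
    rw [inner_add_right, inner_smul_right, inner_sub_right] at h1
    have h3 : ⟪ν r, p⟫ - ⟪ν r, mp⟫ = - (⟪ν r, mp⟫ - lam r) := by linarith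
    rw [h3] at h1
    by_contra h
    have := mul_pos ht0 (h2.lt_of_ne' h)
    linarith
  · rintro (⟨m₁, hm₁, m₂, hm₂, hne, htie, hmin⟩ | ⟨-, mp, hmp, huniq, hnot⟩)
    · refine ⟨hp, 0, fun q _ => by simp, m₁, hm₁, m₂, hm₂, hne, fun m hm => ?_, ?_⟩
      · have := hmin m hm
        simp only [key, inner_zero_left]
        linarith
      · simp only [key, inner_zero_left, htie]
    · obtain ⟨r, hr, hrmp⟩ : ∃ r, ⟪ν r, p⟫ - lam r = 0 ∧ ⟪ν r, mp⟫ - lam r ≠ 0 := by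
        by_contra! h
        exact hnot ⟨hmp.1, h⟩
      obtain ⟨y, hy, hya⟩ := exists_mem_inner_eq_of_mem_convexHull (v := ν r) (a := lam r)
        (hhull ▸ hp) (fun m hm => sub_nonneg.1 ((hP m).1 hm.1 r)) (sub_eq_zero.1 hr)
      have hmpr := ((hP mp).1 hmp.1 r).lt_of_ne' hrmp
      obtain ⟨t, ht, z, hz, hzne, hmax, htie⟩ := exists_nonneg_tie hlatfin
        (f := fun m => - (1 / 2) * quadForm n G (p - m)) (g := fun m => ⟪ν r, m⟫) (x := mp) hy
        (fun m hm => by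
          rcases eq_or_ne m mp with rfl | h
          · exact le_rfl
          · have := huniq m hm h
            linarith)
        (by linarith)
      refine ⟨hp, -(t • ν r), fun q hq => ?_, mp, hmp, z, hz, hzne.symm, fun m hm => ?_, ?_⟩
      · have := mul_nonneg ht ((hP q).1 hq r)
        rw [inner_neg_left, real_inner_smul_left, inner_sub_right, sub_eq_zero.1 hr]
        linarith
      · have := hmax m hm
        simp only [key, inner_neg_left, real_inner_smul_left]
        linarith
      · simp only [key, inner_neg_left, real_inner_smul_left]
        linarith
end
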